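/- arXiv:2510.07250 — 2 statements merged into one kernel-verified Lean document; each statement's English description precedes it below -/
import Mathlib

section
/- Consider the location target with scale τ and negative log-density ψ satisfying Assumption 2, and the truncated signed kernel S*_N built from it with source standard deviation σ > 0. Let N ≥ 1 be an integer and λ > 0. If τ ≥ 8e·λ·σ·N, then S*_N(y|x) ≥ 0 for every pair (x,y) ∈ ℝ² such that (y−x)/τ ∈ A(ψ, 2N, λ). -/
open MeasureTheory Real Filter

/-- The Gaussian source density `u(x;θ)` with standard deviation `σ`. -/
noncomputable def srcDensity (σ θ x : ℝ) : ℝ :=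
  (1 / (Real.sqrt (2 * Real.pi) * σ)) * Real.exp (-(x - θ)^2 / (2 * σ^2))

/-- The location target density `v(y;θ) = (1/τ)·exp(−ψ((y−θ)/τ))`. -/
noncomputable def locDensity (ψ : ℝ → ℝ) (τ y θ : ℝ) : ℝ :=
  (1/τ) * Real.exp (-ψ ((y - θ)/τ))

/-- The weighted derivative sum `Σ_{j=1}^{n} |ψ^{(j)}(t)|/(λ^j·j!)`. -/
noncomputable def derivSum (ψ : ℝ → ℝ) (n : ℕ) (lam t : ℝ) : ℝ :=
  ∑ j ∈ Finset.Icc 1 n, |iteratedDeriv j ψ t| / (lam^j * (Nat.factorial j : ℝ))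

/-- The set `A(ψ,n,λ) = {t : Σ_{j=1}^{n} |ψ^{(j)}(t)|/(λ^j·j!) ≤ 1}`. -/
def ASet (ψ : ℝ → ℝ) (n : ℕ) (lam : ℝ) : Set ℝ :=
  {t : ℝ | derivSum ψ n lam t ≤ 1}

/-- `Err(ψ,n,λ)`. -/
noncomputable def ErrPsi (ψ : ℝ → ℝ) (n : ℕ) (lam : ℝ) : ℝ :=
  (∫ t in (ASet ψ n lam)ᶜ, Real.exp (-ψ t)) +
    ⨆ k ∈ Finset.Icc 1 n,
      ∫ t in (ASet ψ n lam)ᶜ, Real.exp (-ψ t) * (derivSum ψ n lam t)^k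

/-- `M(ψ,n,λ)`. -/
noncomputable def MPsi (ψ : ℝ → ℝ) (n : ℕ) (lam : ℝ) : ℝ :=
  ⨆ k ∈ Finset.Icc 1 n, ⨆ t : ℝ,
    Real.exp (-ψ t + ψ (t/2)) * (1 + (derivSum ψ n lam t)^k)

/-- Assumption 2 on the negative log-density `ψ` with constants `(Cψ, C̃ψ)`. -/
structure Assumption2 (ψ : ℝ → ℝ) (Cψ : ℕ) (Ct : ℝ) : Prop where
  Ct_pos : 0 < Ct
  norm_one : ∫ t : ℝ, Real.exp (-ψ t) = 1
  sq_int : Integrable (fun t : ℝ => Real.exp (-(2 * ψ t)))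
  smooth : ContDiff ℝ (⊤ : ℕ∞) ψ
  moment_int : ∀ n : ℕ, 1 ≤ n → ∀ k : ℕ, 1 ≤ k → k ≤ n →
    Integrable (fun t : ℝ => Real.exp (-ψ t) * (derivSum ψ n Ct t)^k)
  moment_le : ∀ n : ℕ, 1 ≤ n → ∀ k : ℕ, 1 ≤ k → k ≤ n →
    ∫ t : ℝ, Real.exp (-ψ t) * (derivSum ψ n Ct t)^k ≤ (Nat.factorial (Cψ * n) : ℝ)

/-- `C̄ψ = 16π²·(2e)^{4(1+Cψ)}·e^{4(1+Cψ)²}`. -/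
noncomputable def CbarPsi (Cψ : ℕ) : ℝ :=
  16 * Real.pi^2 * (2 * Real.exp 1)^(4*(1+Cψ)) * (Real.exp 1)^(4*(1+Cψ)^2)

/-- The truncated signed kernel `S*_N(y|x)`. -/
noncomputable def signedKernel (σ : ℝ) (v : ℝ → ℝ → ℝ) (N : ℕ) (y x : ℝ) : ℝ :=
  ∑ k ∈ Finset.range (N + 1),
    ((-1 : ℝ)^k * σ^(2*k) / ((2:ℝ)^k * (Nat.factorial k : ℝ))) *
      iteratedDeriv (2*k) (fun θ => v y θ) x

/-- `p(x) = ∫ max(S*_N(y|x), 0) dy`. -/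
noncomputable def pFun (σ : ℝ) (v : ℝ → ℝ → ℝ) (N : ℕ) (x : ℝ) : ℝ :=
  ∫ y : ℝ, max (signedKernel σ v N y x) 0

/-- `q(x) = −∫ min(S*_N(y|x), 0) dy`. -/
noncomputable def qFun (σ : ℝ) (v : ℝ → ℝ → ℝ) (N : ℕ) (x : ℝ) : ℝ :=
  - ∫ y : ℝ, min (signedKernel σ v N y x) 0

/-- The Markov kernel `T*_N(y|x) = max(S*_N(y|x), 0)/p(x)`. -/
noncomputable def markovKernel (σ : ℝ) (v : ℝ → ℝ → ℝ) (N : ℕ) (y x : ℝ) : ℝ :=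
  max (signedKernel σ v N y x) 0 / pFun σ v N x

theorem sum_range_le_derivSum (ψ : ℝ → ℝ) {m n : ℕ} (hmn : m ≤ n) {lam : ℝ} (hlam : 0 < lam)
    (t : ℝ) :
    ∑ i ∈ Finset.range m, |iteratedDeriv (i + 1) ψ t| / (lam ^ (i + 1) * ((i + 1).factorial : ℝ)) ≤
      derivSum ψ n lam t := by
  unfold derivSum
  rw [Finset.range_eq_Ico,
    Finset.sum_Ico_add' (fun j => |iteratedDeriv j ψ t| / (lam ^ j * (j.factorial : ℝ))) 0 m 1]
  refine Finset.sum_le_sum_of_subset_of_nonneg (fun j hj => ?_) fun j _ _ => by positivity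
  simp only [Finset.mem_Ico, Finset.mem_Icc] at hj ⊢
  omega

theorem choose_mul_factorial_le {i m : ℕ} (him : i ≤ m) :
    (m.choose i * (m - i).factorial : ℝ) ≤ (m + 1).factorial / (i + 1).factorial := by
  rw [le_div_iff₀ (by positivity)]
  have h : m.choose i * (m - i).factorial * (i + 1).factorial ≤ (m + 1).factorial := by
    rw [Nat.factorial_succ i, Nat.factorial_succ m, ← Nat.choose_mul_factorial_mul_factorial him]
    calc m.choose i * (m - i).factorial * ((i + 1) * i.factorial)
        = (i + 1) * (m.choose i * i.factorial * (m - i).factorial) := by ring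
      _ ≤ (m + 1) * (m.choose i * i.factorial * (m - i).factorial) := by gcongr
  exact_mod_cast h

/-- On `A(ψ,n,λ)` the derivatives of `e^{-ψ}` up to order `n` are bounded as for a geometric
series of ratio `λ`. -/
theorem abs_iteratedDeriv_exp_neg_le {ψ : ℝ → ℝ} (hψ : ContDiff ℝ (⊤ : ℕ∞) ψ) {n : ℕ} {lam t : ℝ}
    (hlam : 0 < lam) (ht : t ∈ ASet ψ n lam) {m : ℕ} (hm : m ≤ n) :
    |iteratedDeriv m (fun s => Real.exp (-ψ s)) t| ≤ m.factorial * lam ^ m * Real.exp (-ψ t) := by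
  induction m using Nat.strong_induction_on with
  | _ m ih =>
  rcases m with _ | m
  · simp
  have hderiv : deriv (fun s => Real.exp (-ψ s)) =
      fun s => -deriv ψ s * Real.exp (-ψ s) := by
    funext s
    have h := ((hψ.differentiable (by simp)) s).hasDerivAt.neg.exp.deriv
    rw [mul_comm]
    exact h
  have hdψ : ContDiff ℝ m (fun s => -deriv ψ s) := by
    exact (contDiff_succ_iff_deriv.1 (contDiff_infty.1 hψ (m + 1))).2.2.neg
  have hexp : ContDiff ℝ m (fun s => Real.exp (-ψ s)) :=
    (contDiff_infty.1 hψ m).neg.exp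
  rw [iteratedDeriv_succ', hderiv, iteratedDeriv_fun_mul hdψ.contDiffAt hexp.contDiffAt]
  refine (Finset.abs_sum_le_sum_abs _ _).trans ?_
  calc _ ≤ ∑ i ∈ Finset.range (m + 1), ((m + 1).factorial * lam ^ (m + 1) * Real.exp (-ψ t)) *
        (|iteratedDeriv (i + 1) ψ t| / (lam ^ (i + 1) * ((i + 1).factorial : ℝ))) := by
        refine Finset.sum_le_sum fun i hi => ?_
        have him : i ≤ m := Nat.lt_succ_iff.1 (Finset.mem_range.1 hi)
        rw [iteratedDeriv_fun_neg, ← iteratedDeriv_succ', abs_mul, abs_mul, abs_neg, Nat.abs_cast]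
        calc _ ≤ (m.choose i : ℝ) * |iteratedDeriv (i + 1) ψ t| *
              ((m - i).factorial * lam ^ (m - i) * Real.exp (-ψ t)) := by
              gcongr
              exact ih (m - i) (by omega) (by omega)
          _ = (m.choose i * (m - i).factorial) *
              (|iteratedDeriv (i + 1) ψ t| * lam ^ (m - i) * Real.exp (-ψ t)) := by ring
          _ ≤ ((m + 1).factorial / (i + 1).factorial) *
              (|iteratedDeriv (i + 1) ψ t| * lam ^ (m - i) * Real.exp (-ψ t)) := by
              gcongr
              exact choose_mul_factorial_le him
          _ = _ := by
              have : lam ^ (m + 1) = lam ^ (m - i) * lam ^ (i + 1) := by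
                rw [← pow_add]; congr 1; omega
              rw [this]
              field_simp
    _ ≤ _ := by
        rw [← Finset.mul_sum]
        exact mul_le_of_le_one_right (by positivity)
          ((sum_range_le_derivSum ψ hm hlam t).trans ht)

theorem iteratedDeriv_locDensity {ψ : ℝ → ℝ} {n : ℕ} (hψ : ContDiff ℝ n ψ) (τ y x : ℝ) :
    iteratedDeriv n (fun θ => locDensity ψ τ y θ) x =
      1 / τ * ((-1) ^ n * (τ⁻¹ ^ n * iteratedDeriv n (fun s => Real.exp (-ψ s)) ((y - x) / τ))) := by
  have h1 : (fun θ => locDensity ψ τ y θ) =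
      fun θ => 1 / τ * (fun s => Real.exp (-ψ (τ⁻¹ * s))) (y - θ) := by
    funext θ
    simp only [locDensity, div_eq_inv_mul]
  rw [h1, iteratedDeriv_const_mul_field,
    iteratedDeriv_comp_const_sub n (fun s => Real.exp (-ψ (τ⁻¹ * s))) y,
    iteratedDeriv_comp_const_mul (f := fun s => Real.exp (-ψ s)) hψ.neg.exp, div_eq_inv_mul (y - x)]
  rfl

theorem factorial_two_mul_div_le (k : ℕ) :
    ((2 * k).factorial : ℝ) / (2 ^ k * k.factorial) ≤ (k : ℝ) ^ k := by
  rw [div_le_iff₀ (by positivity), ← mul_assoc, ← mul_pow, mul_comm (k : ℝ)]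
  exact_mod_cast Nat.factorial_two_mul_le k

/-- the truncated signed kernel for the location target is
nonnegative whenever `(y−x)/τ ∈ A(ψ, 2N, λ)`, provided `τ ≥ 8e·λ·σ·N`. -/
theorem location_signed_kernel_nonneg
    (σ τ lam : ℝ) (ψ : ℝ → ℝ) (Cψ : ℕ) (Ct : ℝ) (N : ℕ)
    (hψ : Assumption2 ψ Cψ Ct)
    (hN : 1 ≤ N) (hσ : 0 < σ) (hlam : 0 < lam)
    (hτ : 8 * Real.exp 1 * lam * σ * (N:ℝ) ≤ τ) :
    ∀ x y : ℝ, (y - x)/τ ∈ ASet ψ (2*N) lam →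
      0 ≤ signedKernel σ (locDensity ψ τ) N y x := by
  intro x y hxy
  have hN' : (1 : ℝ) ≤ N := by exact_mod_cast hN
  have hτ0 : 0 < τ := lt_of_lt_of_le (by positivity) hτ
  have hratio : (N : ℝ) * (σ * lam * τ⁻¹) ^ 2 ≤ 1 / 2 := by
    have he : (1 : ℝ) ≤ Real.exp 1 := Real.one_le_exp zero_le_one
    have h1 : 2 * N * (σ * lam) ≤ τ := by
      refine le_trans ?_ hτ
      have : 0 < lam * σ * N := by positivity
      nlinarith
    have h2 : N * (σ * lam * τ⁻¹) ≤ 1 / 2 := by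
      rw [← div_eq_mul_inv, ← mul_div_assoc, div_le_iff₀ hτ0]
      linarith
    have h3 : 0 < σ * lam * τ⁻¹ := by positivity
    nlinarith
  have hterm : ∀ k ∈ Finset.range N,
      -(locDensity ψ τ y x * (1 / 2) ^ (k + 1)) ≤
        ((-1 : ℝ) ^ (k + 1) * σ ^ (2 * (k + 1)) / ((2 : ℝ) ^ (k + 1) * ((k + 1).factorial : ℝ))) *
          iteratedDeriv (2 * (k + 1)) (fun θ => locDensity ψ τ y θ) x := by
    intro k hk
    have hkN : k + 1 ≤ N := Finset.mem_range.1 hk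
    generalize k + 1 = j at hkN
    refine neg_le_of_abs_le ?_
    rw [iteratedDeriv_locDensity (contDiff_infty.1 hψ.smooth _)]
    have hbd := abs_iteratedDeriv_exp_neg_le hψ.smooth hlam hxy (m := 2 * j) (by omega)
    have hv : locDensity ψ τ y x = 1 / τ * Real.exp (-ψ ((y - x) / τ)) := rfl
    simp only [abs_mul, abs_div, abs_pow, abs_neg, abs_one, one_pow, one_mul, Nat.abs_cast,
      abs_inv, abs_of_pos hσ, abs_of_pos hτ0, abs_two]
    calc _ ≤ σ ^ (2 * j) / (2 ^ j * j.factorial) * (1 / τ * (τ⁻¹ ^ (2 * j) *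
          ((2 * j).factorial * lam ^ (2 * j) * Real.exp (-ψ ((y - x) / τ))))) := by gcongr
      _ = locDensity ψ τ y x * ((2 * j).factorial / (2 ^ j * j.factorial) *
          ((σ * lam * τ⁻¹) ^ 2) ^ j) := by
          rw [hv, ← pow_mul, mul_pow, mul_pow]
          ring
      _ ≤ locDensity ψ τ y x * ((N : ℝ) ^ j * ((σ * lam * τ⁻¹) ^ 2) ^ j) := by
          rw [hv]
          gcongr
          exact (factorial_two_mul_div_le j).trans (by gcongr)
      _ ≤ locDensity ψ τ y x * (1 / 2) ^ j := by
          rw [hv, ← mul_pow]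
          gcongr
  have hgeom : ∑ k ∈ Finset.range N, (1 / 2 : ℝ) ^ (k + 1) ≤ 1 := by
    simp_rw [pow_succ]
    rw [← Finset.sum_mul]
    linarith [sum_geometric_two_le N]
  have hv : 0 ≤ locDensity ψ τ y x := by
    unfold locDensity
    positivity
  have hsum := Finset.sum_le_sum hterm
  rw [Finset.sum_neg_distrib, ← Finset.mul_sum] at hsum
  rw [signedKernel, Finset.sum_range_succ']
  simp only [mul_zero, pow_zero, Nat.factorial_zero, Nat.cast_one, mul_one, div_one, one_mul,
    iteratedDeriv_zero]
  linarith [mul_le_of_le_one_right hv hgeom]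
end

section
/- Let β ≥ 2 be an even integer and let ψ(t) = t^β − log(β/(2·Γ(1/β))), which is the negative log-density of the generalized normal distribution. Then: (i) ∫_ℝ e^{−ψ(t)} dt = 1 and ∫_ℝ e^{−2ψ(t)} dt < ∞, and for all integers n ≥ 1 and 1 ≤ k ≤ n, ∫_ℝ e^{−ψ(t)}·(Σ_{j=1}^{n} |ψ^{(j)}(t)|/((2β²)^j·j!))^k dt ≤ n!, i.e. Assumption 2 holds with C_ψ = 1 and C̃_ψ = 2β²; and (ii) for every integer n ≥ 1 and every λ ≥ 4n²β², Err(ψ,n,λ) ≤ 3·e^{−√λ} and M(ψ,n,λ) ≤ 3. -/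
open MeasureTheory Real Filter

/-- The generalized normal negative log-density `t ^ β - log (β / (2Γ(1/β)))`. -/
noncomputable abbrev genNormal (β : ℕ) (t : ℝ) : ℝ :=
  t ^ β - Real.log ((β : ℝ) / (2 * Real.Gamma (1 / (β : ℝ))))

/-- The normalizing constant of the generalized normal distribution. -/
noncomputable def genNormalConst (β : ℕ) : ℝ := (β : ℝ) / (2 * Real.Gamma (1 / (β : ℝ)))

lemma genNormalConst_pos {β : ℕ} (hβ : 2 ≤ β) : 0 < genNormalConst β := by
  have h : (0 : ℝ) < β := by positivity
  have := Real.Gamma_pos_of_pos (one_div_pos.2 h)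
  unfold genNormalConst
  positivity

lemma exp_neg_genNormal {β : ℕ} (hβ : 2 ≤ β) (t : ℝ) :
    Real.exp (-genNormal β t) = genNormalConst β * Real.exp (-t ^ β) := by
  rw [genNormal, neg_sub, sub_eq_add_neg, Real.exp_add, ← genNormalConst,
    Real.exp_log (genNormalConst_pos hβ)]

lemma contDiff_genNormal (β : ℕ) : ContDiff ℝ (⊤ : ℕ∞) (genNormal β) :=
  (contDiff_id.pow β).sub contDiff_const

lemma integral_exp_neg_mul_pow_mul_pow {β : ℕ} (hβ : 2 ≤ β) (hβeven : Even β) {b : ℝ}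
    (hb : 0 < b) (k : ℕ) :
    ∫ t : ℝ, Real.exp (-(b * t ^ β)) * (t ^ β) ^ k =
      2 * ((b⁻¹) ^ ((k : ℝ) + 1 / β) * (1 / β) * Real.Gamma (k + 1 / β)) := by
  have hβ0 : (0 : ℝ) < β := by positivity
  have habs := integral_comp_abs (f := fun x : ℝ ↦ Real.exp (-(b * x ^ β)) * (x ^ β) ^ k)
  simp only [hβeven.pow_abs] at habs
  rw [habs]
  congr 1
  have hG := integral_rpow_mul_exp_neg_mul_rpow (p := (β : ℝ)) (q := (β : ℝ) * k) (b := b) hβ0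
    (by have : (0 : ℝ) ≤ β * k := by positivity
        linarith) hb
  have e1 : ((β : ℝ) * k + 1) / β = k + 1 / β := by field_simp
  rw [neg_div, e1, Real.rpow_neg hb.le, ← Real.inv_rpow hb.le] at hG
  rw [← hG]
  refine setIntegral_congr_fun measurableSet_Ioi fun x hx ↦ ?_
  have e2 : x ^ ((β : ℝ) * k) = (x ^ β) ^ k := by
    rw [← pow_mul]; exact_mod_cast Real.rpow_natCast x (β * k)
  simp only [Real.rpow_natCast, e2]
  ring_nf

lemma integrable_exp_neg_mul_pow_mul_pow {β : ℕ} (hβ : 2 ≤ β) (hβeven : Even β) {b : ℝ}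
    (hb : 0 < b) (k : ℕ) :
    Integrable fun t : ℝ ↦ Real.exp (-(b * t ^ β)) * (t ^ β) ^ k := by
  apply Integrable.of_integral_ne_zero
  rw [integral_exp_neg_mul_pow_mul_pow hβ hβeven hb]
  have hβ0 : (0 : ℝ) < β := by positivity
  have := Real.Gamma_pos_of_pos (show (0 : ℝ) < k + 1 / β by positivity)
  positivity

lemma Gamma_natCast_add_le {s : ℝ} (hs : 0 < s) (hs1 : s ≤ 1) (k : ℕ) :
    Real.Gamma (k + s) ≤ k.factorial * Real.Gamma s := by
  induction k with
  | zero => simp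
  | succ k ih =>
    have hpos : 0 < (k : ℝ) + s := by positivity
    rw [show ((k + 1 : ℕ) : ℝ) + s = (k + s) + 1 by push_cast; ring,
      Real.Gamma_add_one hpos.ne', Nat.factorial_succ]
    push_cast
    rw [mul_assoc]
    have := Real.Gamma_pos_of_pos hpos
    gcongr

lemma genNormalConst_mul_integral_le {β : ℕ} (hβ : 2 ≤ β) (hβeven : Even β) {b : ℝ}
    (hb : 0 < b) (k : ℕ) :
    genNormalConst β * ∫ t : ℝ, Real.exp (-(b * t ^ β)) * (t ^ β) ^ k ≤
      (b⁻¹) ^ ((k : ℝ) + 1 / β) * k.factorial := by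
  have hβ0 : (0 : ℝ) < β := by positivity
  have hβ1 : (1 : ℝ) ≤ β := by exact_mod_cast (by lia : 1 ≤ β)
  have hG := Real.Gamma_pos_of_pos (one_div_pos.2 hβ0)
  have hle := Gamma_natCast_add_le (one_div_pos.2 hβ0) (by rw [div_le_one hβ0]; exact hβ1) k
  rw [integral_exp_neg_mul_pow_mul_pow hβ hβeven hb, genNormalConst]
  calc (β : ℝ) / (2 * Real.Gamma (1 / β)) *
        (2 * ((b⁻¹) ^ ((k : ℝ) + 1 / β) * (1 / β) * Real.Gamma (k + 1 / β)))
      = (b⁻¹) ^ ((k : ℝ) + 1 / β) * (Real.Gamma (k + 1 / β) / Real.Gamma (1 / β)) := by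
        field_simp
    _ ≤ _ := by
        gcongr
        rwa [div_le_iff₀ hG]

lemma derivSum_nonneg (ψ : ℝ → ℝ) (n : ℕ) {lam : ℝ} (hlam : 0 ≤ lam) (t : ℝ) :
    0 ≤ derivSum ψ n lam t :=
  Finset.sum_nonneg fun _ _ ↦ by positivity

lemma continuous_derivSum {ψ : ℝ → ℝ} (hψ : ContDiff ℝ (⊤ : ℕ∞) ψ) (n : ℕ) (lam : ℝ) :
    Continuous (derivSum ψ n lam) := by
  refine continuous_finsetSum _ fun j _ ↦ ?_
  exact ((hψ.continuous_iteratedDeriv j (by exact_mod_cast le_top)).abs).div_const _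

lemma abs_pow_sub_le_max {β : ℕ} (hβeven : Even β) (j : ℕ) (t : ℝ) :
    |t| ^ (β - j) ≤ max 1 (t ^ β) := by
  rw [← hβeven.pow_abs t]
  rcases le_total |t| 1 with h | h
  · exact (pow_le_one₀ (abs_nonneg t) h).trans (le_max_left _ _)
  · exact (pow_le_pow_right₀ h (Nat.sub_le _ _)).trans (le_max_right _ _)

lemma derivSum_genNormal_le {β : ℕ} (hβ : 2 ≤ β) (hβeven : Even β) (n : ℕ) {lam : ℝ}
    (hlam : 2 * (β : ℝ) ^ 2 ≤ lam) (t : ℝ) :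
    derivSum (genNormal β) n lam t ≤ 4 / 3 * (β / lam) * max 1 (t ^ β) := by
  have hβ2 : (2 : ℝ) ≤ β := by exact_mod_cast hβ
  have hl : 0 < lam := by nlinarith
  set y : ℝ := β / lam with hy
  have hy0 : 0 ≤ y := by positivity
  have hy4 : y ≤ 1 / 4 := by
    rw [hy, div_le_iff₀ hl]
    nlinarith
  have hterm : ∀ j ∈ Finset.Icc 1 n,
      |iteratedDeriv j (genNormal β) t| / (lam ^ j * (j.factorial : ℝ)) ≤
        y ^ j / j.factorial * max 1 (t ^ β) := by
    intro j hj
    have hj1 : 0 < j := (Finset.mem_Icc.1 hj).1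
    have hd : iteratedDeriv j (genNormal β) t = β.descFactorial j * t ^ (β - j) := by
      have : genNormal β = fun t : ℝ ↦ (-Real.log (genNormalConst β)) + t ^ β := by
        funext t; simp only [genNormal, genNormalConst]; ring
      rw [this, iteratedDeriv_const_add hj1, iteratedDeriv_pow]
    rw [hd, abs_mul, abs_pow, Nat.abs_cast]
    have h1 : (β.descFactorial j : ℝ) ≤ (β : ℝ) ^ j := by
      exact_mod_cast Nat.descFactorial_le_pow β j
    calc (β.descFactorial j : ℝ) * |t| ^ (β - j) / (lam ^ j * j.factorial)
        ≤ (β : ℝ) ^ j * max 1 (t ^ β) / (lam ^ j * j.factorial) := by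
          gcongr
          exact abs_pow_sub_le_max hβeven j t
      _ = _ := by rw [hy, div_pow]; field_simp
  have hsum : ∑ j ∈ Finset.Icc 1 n, y ^ j / (j.factorial : ℝ) ≤ Real.exp y - 1 := by
    have h := Real.sum_le_exp_of_nonneg hy0 (n + 1)
    rw [Finset.range_eq_Ico, Finset.sum_eq_sum_Ico_succ_bot (by lia)] at h
    have hI : Finset.Ico (0 + 1) (n + 1) = Finset.Icc 1 n := by
      ext; simp
    rw [hI] at h
    simp only [pow_zero, Nat.factorial_zero, Nat.cast_one, div_one] at h
    linarith
  have hexp : Real.exp y - 1 ≤ 4 / 3 * y := by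
    have h := (abs_le.1 (Real.abs_exp_sub_one_sub_id_le
      (show |y| ≤ 1 by rw [abs_of_nonneg hy0]; linarith))).2
    nlinarith
  calc derivSum (genNormal β) n lam t
      ≤ ∑ j ∈ Finset.Icc 1 n, y ^ j / j.factorial * max 1 (t ^ β) := Finset.sum_le_sum hterm
    _ = (∑ j ∈ Finset.Icc 1 n, y ^ j / (j.factorial : ℝ)) * max 1 (t ^ β) := by
        rw [Finset.sum_mul]
    _ ≤ _ := by
        gcongr
        exact hsum.trans hexp

lemma exp_neg_mul_derivSum_pow_le {β : ℕ} (hβ : 2 ≤ β) (hβeven : Even β) (n k : ℕ) {lam : ℝ}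
    (hlam : 2 * (β : ℝ) ^ 2 ≤ lam) (t : ℝ) :
    Real.exp (-genNormal β t) * derivSum (genNormal β) n lam t ^ k ≤
      genNormalConst β * (4 / 3 * (β / lam)) ^ k *
        (Real.exp (-(1 * t ^ β)) * (t ^ β) ^ 0 + Real.exp (-(1 * t ^ β)) * (t ^ β) ^ k) := by
  have hl : 0 < lam := lt_of_lt_of_le (by positivity) hlam
  have hu : 0 ≤ t ^ β := hβeven.pow_nonneg t
  have hZ := genNormalConst_pos hβ
  have hmax : (max 1 (t ^ β)) ^ k ≤ 1 + (t ^ β) ^ k := by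
    rcases le_total 1 (t ^ β) with h | h
    · rw [max_eq_right h]; linarith
    · rw [max_eq_left h, one_pow]
      have := pow_nonneg hu k
      linarith
  rw [exp_neg_genNormal hβ]
  calc genNormalConst β * Real.exp (-t ^ β) * derivSum (genNormal β) n lam t ^ k
      ≤ genNormalConst β * Real.exp (-t ^ β) * (4 / 3 * (β / lam) * max 1 (t ^ β)) ^ k := by
        gcongr
        · exact derivSum_nonneg _ _ hl.le _
        · exact derivSum_genNormal_le hβ hβeven n hlam t
    _ ≤ genNormalConst β * Real.exp (-t ^ β) * ((4 / 3 * (β / lam)) ^ k * (1 + (t ^ β) ^ k)) := by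
        rw [mul_pow]
        gcongr
    _ = _ := by rw [one_mul]; ring

lemma integrable_exp_neg_mul_derivSum_pow {β : ℕ} (hβ : 2 ≤ β) (hβeven : Even β) (n k : ℕ)
    {lam : ℝ} (hlam : 2 * (β : ℝ) ^ 2 ≤ lam) :
    Integrable fun t : ℝ ↦
      Real.exp (-genNormal β t) * derivSum (genNormal β) n lam t ^ k := by
  have hl : 0 < lam := lt_of_lt_of_le (by positivity) hlam
  refine (((integrable_exp_neg_mul_pow_mul_pow hβ hβeven one_pos 0).add
    (integrable_exp_neg_mul_pow_mul_pow hβ hβeven one_pos k)).const_mul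
      (genNormalConst β * (4 / 3 * (β / lam)) ^ k)).mono' ?_ ?_
  · exact ((Real.continuous_exp.comp (contDiff_genNormal β).continuous.neg).mul
      ((continuous_derivSum (contDiff_genNormal β) n lam).pow k)).aestronglyMeasurable
  · refine ae_of_all _ fun t ↦ ?_
    have h0 := derivSum_nonneg (genNormal β) n hl.le t
    rw [Real.norm_of_nonneg (by positivity)]
    exact exp_neg_mul_derivSum_pow_le hβ hβeven n k hlam t

lemma assumption2_genNormal {β : ℕ} (hβ : 2 ≤ β) (hβeven : Even β) :
    Assumption2 (genNormal β) 1 (2 * (β : ℝ) ^ 2) where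
  Ct_pos := by positivity
  norm_one := by
    have hβ0 : (0 : ℝ) < β := by positivity
    have hG := Real.Gamma_pos_of_pos (one_div_pos.2 hβ0)
    have h := integral_exp_neg_mul_pow_mul_pow hβ hβeven one_pos 0
    simp only [one_mul, pow_zero, mul_one, inv_one, Real.one_rpow, Nat.cast_zero, zero_add] at h
    simp_rw [exp_neg_genNormal hβ]
    rw [integral_const_mul, h, genNormalConst]
    field_simp
  sq_int := by
    have h := (integrable_exp_neg_mul_pow_mul_pow hβ hβeven two_pos 0).const_mul
      (genNormalConst β ^ 2)
    refine h.congr (ae_of_all _ fun t ↦ ?_)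
    have e : Real.exp (-(2 * genNormal β t)) = Real.exp (-genNormal β t) ^ 2 := by
      rw [← Real.exp_nat_mul]; push_cast; ring_nf
    simp only [e, exp_neg_genNormal hβ, mul_pow, pow_zero, mul_one]
    rw [← Real.exp_nat_mul]; push_cast; ring_nf
  smooth := contDiff_genNormal β
  moment_int n _ k _ _ := integrable_exp_neg_mul_derivSum_pow hβ hβeven n k le_rfl
  moment_le n _ k hk hkn := by
    have hβ2 : (2 : ℝ) ≤ β := by exact_mod_cast hβ
    have hc : 4 / 3 * ((β : ℝ) / (2 * (β : ℝ) ^ 2)) ≤ 1 / 3 := by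
      rw [mul_div_assoc', div_le_iff₀ (by positivity)]
      nlinarith
    have i0 := integrable_exp_neg_mul_pow_mul_pow hβ hβeven one_pos 0
    have ik := integrable_exp_neg_mul_pow_mul_pow hβ hβeven one_pos k
    have h0 := genNormalConst_mul_integral_le hβ hβeven one_pos 0
    have h1 := genNormalConst_mul_integral_le hβ hβeven one_pos k
    simp only [inv_one, Real.one_rpow, one_mul, Nat.factorial_zero, Nat.cast_one] at h0 h1
    have hfac : (1 : ℝ) ≤ k.factorial := by exact_mod_cast k.factorial_pos
    have hpow : (4 / 3 * ((β : ℝ) / (2 * (β : ℝ) ^ 2))) ^ k ≤ 1 / 3 :=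
      (pow_le_of_le_one (by positivity) (by linarith) (by lia)).trans hc
    calc ∫ t : ℝ, Real.exp (-genNormal β t) * derivSum (genNormal β) n (2 * (β : ℝ) ^ 2) t ^ k
        ≤ ∫ t : ℝ, genNormalConst β * (4 / 3 * ((β : ℝ) / (2 * (β : ℝ) ^ 2))) ^ k *
            (Real.exp (-(1 * t ^ β)) * (t ^ β) ^ 0 + Real.exp (-(1 * t ^ β)) * (t ^ β) ^ k) :=
          integral_mono (integrable_exp_neg_mul_derivSum_pow hβ hβeven n k le_rfl)
            ((i0.add ik).const_mul _)
            fun t ↦ exp_neg_mul_derivSum_pow_le hβ hβeven n k le_rfl t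
      _ = (4 / 3 * ((β : ℝ) / (2 * (β : ℝ) ^ 2))) ^ k *
          (genNormalConst β * (∫ t : ℝ, Real.exp (-(1 * t ^ β)) * (t ^ β) ^ 0) +
            genNormalConst β * ∫ t : ℝ, Real.exp (-(1 * t ^ β)) * (t ^ β) ^ k) := by
          rw [integral_const_mul, integral_add i0 ik]; ring
      _ ≤ 1 / 3 * (1 + k.factorial) := by
          simp only [one_mul]
          gcongr
          have := genNormalConst_pos hβ
          have p0 : 0 ≤ ∫ t : ℝ, Real.exp (-t ^ β) * (t ^ β) ^ 0 :=
            integral_nonneg fun t ↦ by positivity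
          have p1 : 0 ≤ ∫ t : ℝ, Real.exp (-t ^ β) * (t ^ β) ^ k :=
            integral_nonneg fun t ↦
              mul_nonneg (Real.exp_pos _).le (pow_nonneg (hβeven.pow_nonneg t) _)
          positivity
      _ ≤ k.factorial := by linarith
      _ ≤ ((1 * n).factorial : ℝ) := by
          rw [one_mul]; exact_mod_cast Nat.factorial_le hkn

lemma two_mul_sq_le_of_le {β n : ℕ} (hn : 1 ≤ n) {lam : ℝ}
    (hlam : 4 * (n : ℝ) ^ 2 * (β : ℝ) ^ 2 ≤ lam) : 2 * (β : ℝ) ^ 2 ≤ lam := by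
  have h1 : (1 : ℝ) ≤ (n : ℝ) ^ 2 := one_le_pow₀ (by exact_mod_cast hn)
  nlinarith [sq_nonneg (β : ℝ)]

lemma natCast_mul_div_le_one_sixth {β n k : ℕ} (hβ : 2 ≤ β) (hn : 1 ≤ n) (hkn : k ≤ n) {lam : ℝ}
    (hlam : 4 * (n : ℝ) ^ 2 * (β : ℝ) ^ 2 ≤ lam) :
    (k : ℝ) * (4 / 3 * (β / lam)) ≤ 1 / 6 := by
  have hβ2 : (2 : ℝ) ≤ β := by exact_mod_cast hβ
  have hn1 : (1 : ℝ) ≤ n := by exact_mod_cast hn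
  have hk : (k : ℝ) ≤ n := by exact_mod_cast hkn
  have hl : 0 < lam := lt_of_lt_of_le (by positivity) hlam
  rw [show (k : ℝ) * (4 / 3 * (β / lam)) = 4 / 3 * (k * β) / lam by ring, div_le_iff₀ hl]
  have h1 : (k : ℝ) * β ≤ n * β := by gcongr
  have h2 : (2 : ℝ) ≤ n * β := by nlinarith
  nlinarith

lemma derivSum_le_and_sqrt_le_of_mem_compl_ASet {β n : ℕ} (hβ : 2 ≤ β) (hβeven : Even β) (hn : 1 ≤ n) {lam : ℝ}
    (hlam : 4 * (n : ℝ) ^ 2 * (β : ℝ) ^ 2 ≤ lam) {t : ℝ} (ht : t ∈ (ASet (genNormal β) n lam)ᶜ) :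
    derivSum (genNormal β) n lam t ≤ 4 / 3 * (β / lam) * t ^ β ∧
      3 / 2 * Real.sqrt lam ≤ t ^ β := by
  have hβ2 : (2 : ℝ) ≤ β := by exact_mod_cast hβ
  have hn1 : (1 : ℝ) ≤ n := by exact_mod_cast hn
  have hl : 0 < lam := lt_of_lt_of_le (by positivity) hlam
  have ht1 : 1 < derivSum (genNormal β) n lam t := not_le.1 ht
  have hd := derivSum_genNormal_le hβ hβeven n (two_mul_sq_le_of_le hn hlam) t
  have ha := natCast_mul_div_le_one_sixth (k := 1) hβ hn hn hlam
  rw [Nat.cast_one, one_mul] at ha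
  have h1 : 1 ≤ t ^ β := by
    by_contra! h
    rw [max_eq_left h.le] at hd
    linarith
  rw [max_eq_right h1] at hd
  refine ⟨hd, ?_⟩
  have hU : 1 < 4 / 3 * (β / lam) * t ^ β := ht1.trans_le hd
  rw [show 4 / 3 * (β / lam) * t ^ β = 4 / 3 * β * t ^ β / lam by ring, one_lt_div hl] at hU
  have hs : 2 * (β : ℝ) ≤ Real.sqrt lam := by
    apply Real.le_sqrt_of_sq_le
    nlinarith [two_mul_sq_le_of_le hn hlam, one_le_pow₀ hn1 (n := 2), sq_nonneg (β : ℝ)]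
  have hsq := Real.mul_self_sqrt hl.le
  have h3 : 2 * (β : ℝ) * Real.sqrt lam ≤ 4 / 3 * β * t ^ β := by
    nlinarith [Real.sqrt_nonneg lam]
  have h4 : (β : ℝ) * (3 / 2 * Real.sqrt lam) ≤ β * t ^ β := by linarith
  exact le_of_mul_le_mul_left h4 (by linarith)

lemma setIntegral_compl_ASet_le {β n : ℕ} (hβ : 2 ≤ β) (hβeven : Even β) (hn : 1 ≤ n) {lam : ℝ}
    (hlam : 4 * (n : ℝ) ^ 2 * (β : ℝ) ^ 2 ≤ lam) (k : ℕ) :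
    ∫ t in (ASet (genNormal β) n lam)ᶜ,
        Real.exp (-genNormal β t) * derivSum (genNormal β) n lam t ^ k ≤
      Real.exp (-Real.sqrt lam) * (4 / 3 * (β / lam)) ^ k *
        (3 ^ ((k : ℝ) + 1 / β) * k.factorial) := by
  have hl : 0 < lam := lt_of_lt_of_le (by positivity) hlam
  have hZ := genNormalConst_pos hβ
  have hA : MeasurableSet (ASet (genNormal β) n lam)ᶜ :=
    (isClosed_le (continuous_derivSum (contDiff_genNormal β) n lam)
      continuous_const).measurableSet.compl
  have hi := (integrable_exp_neg_mul_pow_mul_pow hβ hβeven (b := 1 / 3) (by norm_num) k).const_mul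
    (Real.exp (-Real.sqrt lam) * (4 / 3 * (β / lam)) ^ k * genNormalConst β)
  calc ∫ t in (ASet (genNormal β) n lam)ᶜ,
        Real.exp (-genNormal β t) * derivSum (genNormal β) n lam t ^ k
      ≤ ∫ t in (ASet (genNormal β) n lam)ᶜ,
          Real.exp (-Real.sqrt lam) * (4 / 3 * (β / lam)) ^ k * genNormalConst β *
            (Real.exp (-(1 / 3 * t ^ β)) * (t ^ β) ^ k) := by
        refine setIntegral_mono_on (integrable_exp_neg_mul_derivSum_pow hβ hβeven n k
          (two_mul_sq_le_of_le hn hlam)).integrableOn hi.integrableOn hA fun t ht ↦ ?_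
        obtain ⟨h1, h2⟩ := derivSum_le_and_sqrt_le_of_mem_compl_ASet hβ hβeven hn hlam ht
        have hu : 0 ≤ t ^ β := hβeven.pow_nonneg t
        have hexp : Real.exp (-t ^ β) ≤
            Real.exp (-Real.sqrt lam) * Real.exp (-(1 / 3 * t ^ β)) := by
          rw [← Real.exp_add]
          gcongr
          linarith
        rw [exp_neg_genNormal hβ]
        calc genNormalConst β * Real.exp (-t ^ β) * derivSum (genNormal β) n lam t ^ k
            ≤ genNormalConst β * (Real.exp (-Real.sqrt lam) * Real.exp (-(1 / 3 * t ^ β))) *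
                (4 / 3 * (β / lam) * t ^ β) ^ k := by
              have hd := derivSum_nonneg (genNormal β) n hl.le t
              gcongr
          _ = _ := by rw [mul_pow]; ring
    _ ≤ ∫ t : ℝ, Real.exp (-Real.sqrt lam) * (4 / 3 * (β / lam)) ^ k * genNormalConst β *
            (Real.exp (-(1 / 3 * t ^ β)) * (t ^ β) ^ k) := by
        refine setIntegral_le_integral hi (ae_of_all _ fun t ↦ ?_)
        have hu : 0 ≤ t ^ β := hβeven.pow_nonneg t
        simp only [Pi.zero_apply]
        positivity
    _ = Real.exp (-Real.sqrt lam) * (4 / 3 * (β / lam)) ^ k *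
          (genNormalConst β * ∫ t : ℝ, Real.exp (-(1 / 3 * t ^ β)) * (t ^ β) ^ k) := by
        rw [integral_const_mul]; ring
    _ ≤ _ := by
        have h := genNormalConst_mul_integral_le hβ hβeven (b := 1 / 3) (by norm_num) k
        rw [show ((1 : ℝ) / 3)⁻¹ = 3 by norm_num] at h
        gcongr

lemma three_rpow_one_div_le {β : ℕ} (hβ : 2 ≤ β) : (3 : ℝ) ^ (1 / (β : ℝ)) ≤ 7 / 4 := by
  have hβ2 : (2 : ℝ) ≤ β := by exact_mod_cast hβ
  calc (3 : ℝ) ^ (1 / (β : ℝ)) ≤ 3 ^ (1 / (2 : ℝ)) := by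
        gcongr
        norm_num
    _ = Real.sqrt 3 := (Real.sqrt_eq_rpow 3).symm
    _ ≤ 7 / 4 := Real.sqrt_le_iff.2 (by norm_num)

lemma ErrPsi_genNormal_le {β n : ℕ} (hβ : 2 ≤ β) (hβeven : Even β) (hn : 1 ≤ n) {lam : ℝ}
    (hlam : 4 * (n : ℝ) ^ 2 * (β : ℝ) ^ 2 ≤ lam) :
    ErrPsi (genNormal β) n lam ≤ 3 * Real.exp (-Real.sqrt lam) := by
  have hl : 0 < lam := lt_of_lt_of_le (by positivity) hlam
  have h3 := three_rpow_one_div_le hβ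
  have hE := Real.exp_pos (-Real.sqrt lam)
  have hmass : ∫ t in (ASet (genNormal β) n lam)ᶜ, Real.exp (-genNormal β t) ≤
      7 / 4 * Real.exp (-Real.sqrt lam) := by
    have h := setIntegral_compl_ASet_le hβ hβeven hn hlam 0
    simp only [pow_zero, mul_one, Nat.cast_zero, zero_add, Nat.factorial_zero, Nat.cast_one] at h
    nlinarith
  have hmoment : ∀ k ∈ Finset.Icc 1 n, ∫ t in (ASet (genNormal β) n lam)ᶜ,
      Real.exp (-genNormal β t) * derivSum (genNormal β) n lam t ^ k ≤
        7 / 8 * Real.exp (-Real.sqrt lam) := by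
    intro k hk
    obtain ⟨hk1, hkn⟩ := Finset.mem_Icc.1 hk
    refine (setIntegral_compl_ASet_le hβ hβeven hn hlam k).trans ?_
    have hc := natCast_mul_div_le_one_sixth hβ hn hkn hlam
    set a : ℝ := 4 / 3 * (β / lam) with ha
    have ha0 : 0 ≤ a := by positivity
    have hfac : (k.factorial : ℝ) ≤ (k : ℝ) ^ k := by exact_mod_cast k.factorial_le_pow
    have hhalf : (3 * (k * a)) ^ k ≤ 1 / 2 :=
      (pow_le_of_le_one (by positivity) (by linarith) (by lia)).trans (by linarith)
    rw [Real.rpow_add (by norm_num), Real.rpow_natCast]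
    calc Real.exp (-Real.sqrt lam) * a ^ k * (3 ^ k * 3 ^ (1 / (β : ℝ)) * k.factorial)
        ≤ Real.exp (-Real.sqrt lam) * a ^ k * (3 ^ k * (7 / 4) * (k : ℝ) ^ k) := by gcongr
      _ = 7 / 4 * Real.exp (-Real.sqrt lam) * (3 * (k * a)) ^ k := by
          rw [mul_pow, mul_pow]; ring
      _ ≤ 7 / 4 * Real.exp (-Real.sqrt lam) * (1 / 2) := by gcongr
      _ = _ := by ring
  have hsup := Real.iSup_le (fun k ↦ Real.iSup_le (hmoment k) (by positivity)) (by positivity)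
  unfold ErrPsi
  linarith

lemma MPsi_genNormal_le {β n : ℕ} (hβ : 2 ≤ β) (hβeven : Even β) (hn : 1 ≤ n) {lam : ℝ}
    (hlam : 4 * (n : ℝ) ^ 2 * (β : ℝ) ^ 2 ≤ lam) :
    MPsi (genNormal β) n lam ≤ 3 := by
  have hl : 0 < lam := lt_of_lt_of_le (by positivity) hlam
  refine Real.iSup_le (fun k ↦ Real.iSup_le (fun hk ↦ Real.iSup_le (fun t ↦ ?_)
    zero_le_three) zero_le_three) zero_le_three
  have hc := natCast_mul_div_le_one_sixth hβ hn (Finset.mem_Icc.1 hk).2 hlam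
  have hd := derivSum_genNormal_le hβ hβeven n (two_mul_sq_le_of_le hn hlam) t
  have hd0 := derivSum_nonneg (genNormal β) n hl.le t
  have hu : 0 ≤ t ^ β := hβeven.pow_nonneg t
  have hpow : derivSum (genNormal β) n lam t ^ k ≤ Real.exp ((1 + t ^ β) / 6) := by
    set a : ℝ := 4 / 3 * (β / lam)
    have ha0 : 0 ≤ a := by positivity
    have hmax : max 1 (t ^ β) ≤ 1 + t ^ β := max_le (by linarith) (by linarith)
    have h1 : derivSum (genNormal β) n lam t ≤ Real.exp (a * (1 + t ^ β)) :=
      (hd.trans (by gcongr)).trans ((by linarith : a * (1 + t ^ β) ≤ a * (1 + t ^ β) + 1).trans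
        (Real.add_one_le_exp _))
    refine (pow_le_pow_left₀ hd0 h1 k).trans ?_
    rw [← Real.exp_nat_mul]
    gcongr
    nlinarith
  have hhalf : (t / 2) ^ β ≤ t ^ β / 4 := by
    rw [div_pow]
    have : (4 : ℝ) ≤ 2 ^ β := by
      calc (4 : ℝ) = 2 ^ 2 := by norm_num
        _ ≤ 2 ^ β := pow_le_pow_right₀ (by norm_num) hβ
    gcongr
  have hexp : Real.exp (-genNormal β t + genNormal β (t / 2)) ≤ Real.exp (-(3 / 4 * t ^ β)) := by
    gcongr
    simp only [genNormal]
    linarith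
  have hone : Real.exp (1 / 6) ≤ 2 := by
    have h := (abs_le.1 (Real.abs_exp_sub_one_sub_id_le
      (show |(1 / 6 : ℝ)| ≤ 1 by rw [abs_of_nonneg] <;> norm_num))).2
    linarith
  calc Real.exp (-genNormal β t + genNormal β (t / 2)) *
        (1 + derivSum (genNormal β) n lam t ^ k)
      ≤ Real.exp (-(3 / 4 * t ^ β)) * (1 + Real.exp ((1 + t ^ β) / 6)) := by gcongr
    _ = Real.exp (-(3 / 4 * t ^ β)) + Real.exp (-(3 / 4 * t ^ β) + (1 + t ^ β) / 6) := by
        rw [Real.exp_add]; ring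
    _ ≤ 1 + Real.exp (1 / 6) := by
        gcongr
        · exact Real.exp_le_one_iff.2 (by linarith)
        · linarith
    _ ≤ 3 := by linarith

/-- Corollary 2: the generalized normal negative log-density
`ψ(t) = t^β − log(β/(2Γ(1/β)))` (β ≥ 2 even) satisfies Assumption 2 with
`Cψ = 1`, `C̃ψ = 2β²`, and for `λ ≥ 4n²β²` one has `Err(ψ,n,λ) ≤ 3e^{−√λ}`
and `M(ψ,n,λ) ≤ 3`. -/
theorem generalized_normal_log_density
    (β : ℕ) (hβ : 2 ≤ β) (hβeven : Even β) :
    Assumption2 (fun t : ℝ => t^β - Real.log ((β : ℝ) / (2 * Real.Gamma (1/(β:ℝ)))))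
      1 (2 * (β:ℝ)^2) ∧
    (∀ n : ℕ, 1 ≤ n → ∀ lam : ℝ, 4 * (n:ℝ)^2 * (β:ℝ)^2 ≤ lam →
      ErrPsi (fun t : ℝ => t^β - Real.log ((β : ℝ) / (2 * Real.Gamma (1/(β:ℝ))))) n lam
          ≤ 3 * Real.exp (-Real.sqrt lam) ∧
      MPsi (fun t : ℝ => t^β - Real.log ((β : ℝ) / (2 * Real.Gamma (1/(β:ℝ))))) n lam
          ≤ 3) := by
  exact ⟨assumption2_genNormal hβ hβeven, fun n hn lam hlam ↦
    ⟨ErrPsi_genNormal_le hβ hβeven hn hlam, MPsi_genNormal_le hβ hβeven hn hlam⟩⟩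
end
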